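/- Let (A,B) and (C,D) be two mixed-k-separations of a k-connected graph G that cross so that two opposite corner-separators have size at least k. Then either (1) all four links have the same size ℓ and the centre has size k − 2ℓ, for some ℓ ≤ ⌊k/2⌋; or (2) two adjacent links have size i, the other two links have size j, and the centre has size k − i − j, where 1 ≤ i ≤ ⌊(k−1)/2⌋ and i < j ≤ k − i. -/

import Mathlib

open Set

namespace Paper

variable {V : Type*}

/-- The set of edges of `G` with one endvertex in `A \ B` and the other in `B \ A`. -/
def sepEdges (G : SimpleGraph V) (A B : Set V) : Set (Sym2 V) :=
  {e | e ∈ G.edgeSet ∧ ∃ a b : V, e = s(a, b) ∧ a ∈ A \ B ∧ b ∈ B \ A}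

/-- The order of the mixed-separation `(A, B)`: the number of vertices of `A ∩ B`
plus the number of edges between `A \ B` and `B \ A`. -/
noncomputable def sepOrder (G : SimpleGraph V) (A B : Set V) : ℕ∞ :=
  (A ∩ B).encard + (sepEdges G A B).encard

/-- A mixed-separation⁺: a pair of vertex sets covering the whole graph. -/
def IsMixedSepPlus (A B : Set V) : Prop := A ∪ B = Set.univ

/-- A (proper) mixed-separation. -/
def IsMixedSep (A B : Set V) : Prop :=
  A ∪ B = Set.univ ∧ (A \ B).Nonempty ∧ (B \ A).Nonempty

/-- `G` is `k`-connected: it has more than `k` vertices and deleting fewer than `k`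
vertices keeps it connected. -/
def KConnected (G : SimpleGraph V) (k : ℕ) : Prop :=
  (k : ℕ∞) < (Set.univ : Set V).encard ∧
    ∀ X : Set V, X.encard < (k : ℕ∞) → (G.induce (Xᶜ : Set V)).Connected

/-- Every vertex of `A ∩ B` has at least two neighbours in `A \ B`
and at least two neighbours in `B \ A`. -/
def DegreeCondition (G : SimpleGraph V) (A B : Set V) : Prop :=
  ∀ v ∈ A ∩ B,
    2 ≤ (G.neighborSet v ∩ (A \ B)).encard ∧ 2 ≤ (G.neighborSet v ∩ (B \ A)).encard

/-- No two edges in the separator of `(A,B)` share an endvertex. -/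
def MatchingCondition (G : SimpleGraph V) (A B : Set V) : Prop :=
  ∀ e ∈ sepEdges G A B, ∀ f ∈ sepEdges G A B, e ≠ f → ∀ v : V, v ∈ e → v ∉ f

/-- A tetra-separation. -/
def IsTetraSep (G : SimpleGraph V) (A B : Set V) : Prop :=
  IsMixedSep A B ∧ sepOrder G A B = 4 ∧ DegreeCondition G A B ∧ MatchingCondition G A B

/-- `(A,B) ≤ (C,D)`. -/
def LeSep (A B C D : Set V) : Prop := A ⊆ C ∧ D ⊆ B

/-- `(A,B)` and `(C,D)` are nested. -/
def Nested (A B C D : Set V) : Prop :=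
  LeSep A B C D ∨ LeSep A B D C ∨ LeSep B A C D ∨ LeSep B A D C

/-- `(A,B)` and `(C,D)` cross. -/
def Crosses (A B C D : Set V) : Prop := ¬ Nested A B C D

/-- The corner for the sides `A` and `C` of the pair `(A,B)`, `(C,D)`. -/
def corner (A B C D : Set V) : Set V := (A \ B) ∩ (C \ D)

/-- The vertex-centre of the crossing-diagram of `(A,B)` and `(C,D)`. -/
def vertexCentre (A B C D : Set V) : Set V := A ∩ B ∩ C ∩ D

/-- An edge is diagonal if its endvertices lie in opposite corners. -/
def IsDiagonal (G : SimpleGraph V) (A B C D : Set V) (e : Sym2 V) : Prop :=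
  e ∈ G.edgeSet ∧ ∃ a b : V, e = s(a, b) ∧
    ((a ∈ corner A B C D ∧ b ∈ corner B A D C) ∨
     (a ∈ corner A B D C ∧ b ∈ corner B A C D))

/-- The `C`-link of the crossing diagram of `(A,B)` and `(C,D)`: all non-diagonal
edges of `S(A,B)` with an endvertex in the corner for `AC` or for `BC`, together with
all vertices of `(C \ D) ∩ S(A,B)`.  (The `D`-link is `link G A B D C`, the `A`-link
is `link G C D A B`, the `B`-link is `link G C D B A`.) -/
def link (G : SimpleGraph V) (A B C D : Set V) : Set (V ⊕ Sym2 V) :=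
  Sum.inl '' ((C \ D) ∩ (A ∩ B)) ∪
    Sum.inr '' {e | e ∈ sepEdges G A B ∧ ¬ IsDiagonal G A B C D e ∧
      ∃ v : V, v ∈ e ∧ (v ∈ corner A B C D ∨ v ∈ corner B A C D)}

/-- The centre: the vertex-centre together with all diagonal edges. -/
def centre (G : SimpleGraph V) (A B C D : Set V) : Set (V ⊕ Sym2 V) :=
  Sum.inl '' vertexCentre A B C D ∪ Sum.inr '' {e | IsDiagonal G A B C D e}

/-- The corner-separator `L(A,C)`: the union of the `A`-link, the `C`-link, the
vertex-centre and the diagonal edges with an endvertex in the corner for `AC`. -/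
def cornerSep (G : SimpleGraph V) (A B C D : Set V) : Set (V ⊕ Sym2 V) :=
  link G C D A B ∪ link G A B C D ∪ Sum.inl '' vertexCentre A B C D ∪
    Sum.inr '' {e | IsDiagonal G A B C D e ∧ ∃ v : V, v ∈ e ∧ v ∈ corner A B C D}

/-- An edge is jumping if its endvertices lie in opposite links. -/
def IsJumping (G : SimpleGraph V) (A B C D : Set V) (e : Sym2 V) : Prop :=
  e ∈ G.edgeSet ∧ ∃ a b : V, e = s(a, b) ∧
    ((Sum.inl a ∈ link G C D A B ∧ Sum.inl b ∈ link G C D B A) ∨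
     (Sum.inl a ∈ link G A B C D ∧ Sum.inl b ∈ link G A B D C))

/-- An edge dangles from `fromLink` through `throughLink` if it has an endvertex
that is a vertex of `fromLink` and the edge itself is an element of `throughLink`. -/
def DanglesFromThrough (G : SimpleGraph V) (fromLink throughLink : Set (V ⊕ Sym2 V))
    (e : Sym2 V) : Prop :=
  e ∈ G.edgeSet ∧ (∃ v : V, v ∈ e ∧ Sum.inl v ∈ fromLink) ∧ Sum.inr e ∈ throughLink

/-- The corner for `A` and `C` is potter. -/
def Potter (G : SimpleGraph V) (A B C D : Set V) : Prop :=
  corner A B C D = ∅ ∧ (link G C D A B).encard = 2 ∧ (link G A B C D).encard = 2 ∧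
    ∃ u₁ u₂ u₃ u₄ : V, G.Adj u₁ u₂ ∧ G.Adj u₂ u₃ ∧ G.Adj u₃ u₄ ∧
      List.Nodup [u₁, u₂, u₃, u₄] ∧
      Sum.inl u₂ ∈ link G A B C D ∧ Sum.inr (s(u₁, u₂)) ∈ link G C D A B ∧
      Sum.inl u₃ ∈ link G C D A B ∧ Sum.inr (s(u₃, u₄)) ∈ link G A B C D

/-- All four links have size two and the centre is empty. -/
def LinksTwoCentreEmpty (G : SimpleGraph V) (A B C D : Set V) : Prop :=
  (link G C D A B).encard = 2 ∧ (link G C D B A).encard = 2 ∧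
    (link G A B C D).encard = 2 ∧ (link G A B D C).encard = 2 ∧
    centre G A B C D = ∅

/-- `(A,B)` is half-connected. -/
def HalfConnected (G : SimpleGraph V) (A B : Set V) : Prop :=
  (G.induce (A \ B)).Connected ∨ (G.induce (B \ A)).Connected

/-- First component of the left-reduction of `(A,B)`: delete from `A` the vertices of
`A ∩ B` with at most one neighbour in `A \ B`.  (The left-reduction of `(A,B)` is
`(leftRed G A B, B)`; the right-reduction is `(A, leftRed G B A)`.) -/
def leftRed (G : SimpleGraph V) (A B : Set V) : Set V :=
  A \ {v | v ∈ A ∩ B ∧ (G.neighborSet v ∩ (A \ B)).encard ≤ 1}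

/-- The separator of `(A,B)` as a set of vertices and edges. -/
def sepElems (G : SimpleGraph V) (A B : Set V) : Set (V ⊕ Sym2 V) :=
  Sum.inl '' (A ∩ B) ∪ Sum.inr '' sepEdges G A B

/-- `x̂`: the endvertices of an element of the separator. -/
def hat : V ⊕ Sym2 V → Set V
  | Sum.inl v => {v}
  | Sum.inr e => {w | w ∈ e}

/-- `X̂` for a set `X` of vertices and edges. -/
def hatSet (π : Set (V ⊕ Sym2 V)) : Set V := ⋃ x ∈ π, hat x

/-- Inner vertices of a walk. -/
def innerVerts (G : SimpleGraph V) {u v : V} (p : G.Walk u v) : Set V :=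
  {w | w ∈ p.support ∧ w ≠ u ∧ w ≠ v}

/-- An `X`–`Y` path: a path starting in `X`, ending in `Y`, with no other
vertex in `X ∪ Y`. -/
def IsXYPath (G : SimpleGraph V) (X Y : Set V) {u v : V} (p : G.Walk u v) : Prop :=
  p.IsPath ∧ u ∈ X ∧ v ∈ Y ∧ ∀ w ∈ p.support, w ∈ X ∪ Y → w = u ∨ w = v

/-- A walk avoids a vertex (it is not on the walk) or an edge (it is not used). -/
def WalkAvoids (G : SimpleGraph V) {u v : V} (p : G.Walk u v) (x : V ⊕ Sym2 V) : Prop :=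
  Sum.elim (fun w => w ∉ p.support) (fun e => e ∉ p.edges) x

/-- There are `n` pairwise independent `X`–`Y` paths in `G`
(no path contains an inner vertex of another). -/
def HasIndepPaths (G : SimpleGraph V) (X Y : Set V) (n : ℕ) : Prop :=
  ∃ (a b : Fin n → V) (p : ∀ i, G.Walk (a i) (b i)),
    (∀ i, IsXYPath G X Y (p i)) ∧
      ∀ i j, i ≠ j → ∀ w ∈ innerVerts G (p i), w ∉ (p j).support

/-- Maximum number of pairwise independent `X`–`Y` paths in `G`. -/
noncomputable def maxIndepPaths (G : SimpleGraph V) (X Y : Set V) : ℕ∞ :=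
  sSup {n : ℕ∞ | ∃ m : ℕ, n = (m : ℕ∞) ∧ HasIndepPaths G X Y m}

/-- `(A,B)` strongly separates `X` and `Y`. -/
def StronglySeparates (A B X Y : Set V) : Prop := X ⊆ A \ B ∧ Y ⊆ B \ A

/-- Minimum order of a mixed-separation of `G` strongly separating `X` and `Y`. -/
noncomputable def minSepOrder (G : SimpleGraph V) (X Y : Set V) : ℕ∞ :=
  sInf {n : ℕ∞ | ∃ A B : Set V,
    IsMixedSep A B ∧ StronglySeparates A B X Y ∧ sepOrder G A B = n}

/-- A `k`-separation: a mixed-separation of order `k` whose separator has no edges. -/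
def IsVertexSep (G : SimpleGraph V) (A B : Set V) (k : ℕ) : Prop :=
  IsMixedSep A B ∧ sepEdges G A B = ∅ ∧ sepOrder G A B = (k : ℕ∞)

/-- `G` is quasi-`k`-connected: `(k-1)`-connected and every `(k-1)`-separation has a
side whose proper part is a single vertex. -/
def QuasiConnected (G : SimpleGraph V) (k : ℕ) : Prop :=
  KConnected G (k - 1) ∧
    ∀ A B : Set V, IsVertexSep G A B (k - 1) →
      (A \ B).encard = 1 ∨ (B \ A).encard = 1

/-- `{x₁,x₂}` is 3-linked around the separator `{x₁,x₂,x₃,x₄}`. -/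
def ThreeLinkedAround (G : SimpleGraph V) (x₁ x₂ x₃ x₄ : V ⊕ Sym2 V) : Prop :=
  (∃ e : Sym2 V, x₃ = Sum.inr e) ∨ (∃ e : Sym2 V, x₄ = Sum.inr e) ∨
    (((∃ v : V, x₁ = Sum.inl v) ∨ (∃ v : V, x₂ = Sum.inl v)) ∧
      ∃ a b : V, G.Adj a b ∧ a ∈ hat x₁ ∧ b ∈ hat x₂) ∨
    (∃ (a b : Fin 3 → V) (p : ∀ i, G.Walk (a i) (b i)),
      (∀ i, IsXYPath G (hat x₁) (hat x₂) (p i) ∧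
        WalkAvoids G (p i) x₃ ∧ WalkAvoids G (p i) x₄) ∧
      ∀ i j, i ≠ j → ∀ w ∈ innerVerts G (p i), w ∉ (p j).support)

/-- `G` is 4-angry: 4-connected and every tetra-separation is crossed. -/
def FourAngry (G : SimpleGraph V) : Prop :=
  KConnected G 4 ∧
    ∀ A B : Set V, IsTetraSep G A B → ∃ C D : Set V, IsTetraSep G C D ∧ Crosses A B C D

/-- `G` is a sprinkled `K₄,ₘ`: a set `X` of four vertices, whose complement has
exactly `m` elements, is independent and completely joined to `X`
(edges inside `X` arbitrary). -/
def IsSprinkledK4m (G : SimpleGraph V) (m : ℕ∞) : Prop :=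
  ∃ X : Set V, X.encard = 4 ∧ (Xᶜ : Set V).encard = m ∧
    (∀ a b : V, a ∉ X → b ∉ X → ¬ G.Adj a b) ∧
    ∀ a : V, a ∉ X → ∀ x ∈ X, G.Adj a x

/-- The diagonal edges joining the corner for `AC` to the corner for `BD`. -/
def diagonalEdges (G : SimpleGraph V) (A B C D : Set V) : Set (Sym2 V) :=
  {e | e ∈ G.edgeSet ∧ ∃ a b : V, e = s(a, b) ∧ a ∈ corner A B C D ∧ b ∈ corner B A D C}

lemma diagonalEdges_swap (G : SimpleGraph V) (A B C D : Set V) :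
    diagonalEdges G C D B A = diagonalEdges G A B D C := by
  ext e
  simp only [diagonalEdges, corner, mem_ofPred_eq, mem_inter_iff]
  constructor
  · rintro ⟨he, a, b, rfl, ha, hb⟩
    exact ⟨he, b, a, Sym2.eq_swap, hb.symm, ha.symm⟩
  · rintro ⟨he, a, b, rfl, ha, hb⟩
    exact ⟨he, b, a, Sym2.eq_swap, hb.symm, ha.symm⟩

lemma diagonalEdges_flip (G : SimpleGraph V) (A B C D : Set V) :
    diagonalEdges G B A D C = diagonalEdges G A B C D := by
  ext e
  simp only [diagonalEdges, mem_ofPred_eq]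
  constructor
  · rintro ⟨he, a, b, rfl, ha, hb⟩
    exact ⟨he, b, a, Sym2.eq_swap, hb, ha⟩
  · rintro ⟨he, a, b, rfl, ha, hb⟩
    exact ⟨he, b, a, Sym2.eq_swap, hb, ha⟩

lemma isDiagonal_iff (G : SimpleGraph V) (A B C D : Set V) (e : Sym2 V) :
    IsDiagonal G A B C D e ↔ e ∈ diagonalEdges G A B C D ∪ diagonalEdges G A B D C := by
  simp only [IsDiagonal, diagonalEdges, mem_union, mem_ofPred_eq]
  grind

lemma isDiagonal_swap_right (G : SimpleGraph V) (A B C D : Set V) (e : Sym2 V) :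
    IsDiagonal G A B D C e ↔ IsDiagonal G A B C D e := by
  rw [isDiagonal_iff, isDiagonal_iff, union_comm]

lemma isDiagonal_swap_left (G : SimpleGraph V) (A B C D : Set V) (e : Sym2 V) :
    IsDiagonal G B A C D e ↔ IsDiagonal G A B C D e := by
  unfold IsDiagonal
  refine and_congr_right fun _ => ?_
  constructor
  · rintro ⟨a, b, rfl, h⟩
    exact ⟨b, a, Sym2.eq_swap, by tauto⟩
  · rintro ⟨a, b, rfl, h⟩
    exact ⟨b, a, Sym2.eq_swap, by tauto⟩

lemma isDiagonal_swap (G : SimpleGraph V) (A B C D : Set V) (e : Sym2 V) :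
    IsDiagonal G C D A B e ↔ IsDiagonal G A B C D e := by
  rw [isDiagonal_iff, isDiagonal_iff, diagonalEdges_swap, diagonalEdges_swap G A B C D,
    diagonalEdges_flip]

lemma sepEdges_comm (G : SimpleGraph V) (A B : Set V) : sepEdges G B A = sepEdges G A B := by
  ext e
  unfold sepEdges
  refine and_congr_right fun _ => ?_
  constructor
  · rintro ⟨a, b, rfl, h⟩
    exact ⟨b, a, Sym2.eq_swap, h.symm⟩
  · rintro ⟨a, b, rfl, h⟩
    exact ⟨b, a, Sym2.eq_swap, h.symm⟩

lemma link_swap_left (G : SimpleGraph V) (A B C D : Set V) :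
    link G B A C D = link G A B C D := by
  simp only [link, sepEdges_comm G A B, isDiagonal_swap_left, inter_comm B A,
    or_comm (a := _ ∈ corner B A C D)]

lemma vertexCentre_swap (A B C D : Set V) : vertexCentre C D A B = vertexCentre A B C D := by
  ext v
  simp only [vertexCentre, mem_inter_iff]
  tauto

lemma centre_swap_right (G : SimpleGraph V) (A B C D : Set V) :
    centre G A B D C = centre G A B C D := by
  simp only [centre, vertexCentre, isDiagonal_swap_right, inter_assoc, inter_comm D C]

lemma centre_swap (G : SimpleGraph V) (A B C D : Set V) :
    centre G C D A B = centre G A B C D := by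
  simp only [centre, isDiagonal_swap, vertexCentre_swap A B C D]

lemma Crosses.symm {A B C D : Set V} (h : Crosses A B C D) : Crosses C D A B := by
  unfold Crosses Nested LeSep at *
  tauto

lemma Crosses.swap_right {A B C D : Set V} (h : Crosses A B C D) : Crosses A B D C := by
  unfold Crosses Nested at *
  tauto

lemma IsMixedSep.symm {A B : Set V} (h : IsMixedSep A B) : IsMixedSep B A :=
  ⟨by rw [union_comm]; exact h.1, h.2.2, h.2.1⟩

lemma sepOrder_comm (G : SimpleGraph V) (A B : Set V) : sepOrder G B A = sepOrder G A B := by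
  rw [sepOrder, sepOrder, inter_comm, sepEdges_comm]

lemma encard_inl_union_inr {α β : Type*} (s : Set α) (t : Set β) :
    (Sum.inl '' s ∪ Sum.inr '' t : Set (α ⊕ β)).encard = s.encard + t.encard := by
  rw [encard_union_eq, Sum.inl_injective.encard_image, Sum.inr_injective.encard_image]
  exact disjoint_left.2 (by rintro _ ⟨a, _, rfl⟩ ⟨b, _, h⟩; cases h)

lemma encard_sepElems (G : SimpleGraph V) (A B : Set V) :
    (sepElems G A B).encard = sepOrder G A B :=
  encard_inl_union_inr _ _

lemma disjoint_diagonalEdges (G : SimpleGraph V) (A B C D : Set V) :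
    Disjoint (diagonalEdges G A B C D) (diagonalEdges G A B D C) := by
  refine disjoint_left.2 ?_
  rintro _ ⟨_, a, b, rfl, ha, hb⟩ ⟨_, a', b', h, ha', hb'⟩
  simp only [corner, mem_inter_iff, mem_sdiff] at *
  rcases Sym2.eq_iff.1 h with ⟨rfl, rfl⟩ | ⟨rfl, rfl⟩ <;> tauto

lemma encard_centre (G : SimpleGraph V) (A B C D : Set V) :
    (centre G A B C D).encard = (vertexCentre A B C D).encard +
      ((diagonalEdges G A B C D).encard + (diagonalEdges G A B D C).encard) := by
  rw [centre, encard_inl_union_inr, ← encard_union_eq (disjoint_diagonalEdges G A B C D)]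
  simp only [isDiagonal_iff, ofPred_mem_eq]

lemma encard_cornerSep_le (G : SimpleGraph V) (A B C D : Set V) :
    (cornerSep G A B C D).encard ≤ (link G C D A B).encard + (link G A B C D).encard +
      (vertexCentre A B C D).encard + (diagonalEdges G A B C D).encard := by
  have h : {e | IsDiagonal G A B C D e ∧ ∃ v : V, v ∈ e ∧ v ∈ corner A B C D} ⊆
      diagonalEdges G A B C D := by
    rintro e ⟨he, v, hv, hvc⟩
    rcases (isDiagonal_iff G A B C D e).1 he with h | ⟨_, a, b, rfl, ha, hb⟩
    · exact h
    · simp only [corner, mem_inter_iff, mem_sdiff] at *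
      rcases Sym2.mem_iff.1 hv with rfl | rfl <;> tauto
  refine (encard_union_le _ _).trans (add_le_add ((encard_union_le _ _).trans
    (add_le_add (encard_union_le _ _) ?_)) ?_)
  · rw [Sum.inl_injective.encard_image]
  · rw [Sum.inr_injective.encard_image]
    exact encard_le_encard h

lemma link_subset_sepElems (G : SimpleGraph V) (A B C D : Set V) :
    link G A B C D ⊆ sepElems G A B :=
  union_subset_union (image_mono inter_subset_right) (image_mono fun _ he => he.1)

lemma centre_subset_sepElems (G : SimpleGraph V) (A B C D : Set V) :
    centre G A B C D ⊆ sepElems G A B := by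
  refine union_subset_union (image_mono fun v hv => hv.1.1) (image_mono ?_)
  rintro _ ⟨he, a, b, rfl, h⟩
  rcases h with ⟨ha, hb⟩ | ⟨ha, hb⟩ <;> exact ⟨he, a, b, rfl, ha.1, hb.1⟩

lemma disjoint_link_centre (G : SimpleGraph V) (A B C D : Set V) :
    Disjoint (link G A B C D) (centre G A B C D) := by
  refine disjoint_left.2 ?_
  rintro _ (⟨v, hv, rfl⟩ | ⟨e, he, rfl⟩) (⟨w, hw, h⟩ | ⟨f, hf, h⟩)
  · cases h
    exact hv.1.2 hw.2
  · cases h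
  · cases h
  · cases h
    exact he.2.1 hf

lemma disjoint_link_link (G : SimpleGraph V) (A B C D : Set V) :
    Disjoint (link G A B C D) (link G A B D C) := by
  refine disjoint_left.2 ?_
  rintro _ (⟨v, hv, rfl⟩ | ⟨e, ⟨⟨heG, a, b, rfl, ha, hb⟩, hnd, v, hve, hv⟩, rfl⟩)
    (⟨w, hw, h⟩ | ⟨f, ⟨-, -, w, hwe, hw⟩, h⟩)
  · cases h
    exact hv.1.2 hw.1.1
  · cases h
  · cases h
  · cases h
    refine hnd ⟨heG, a, b, rfl, ?_⟩
    simp only [corner, mem_inter_iff, mem_sdiff] at *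
    rcases Sym2.mem_iff.1 hve with rfl | rfl <;>
      rcases Sym2.mem_iff.1 hwe with rfl | rfl <;> tauto

lemma link_add_link_add_centre_le (G : SimpleGraph V) (A B C D : Set V) :
    (link G A B C D).encard + (link G A B D C).encard + (centre G A B C D).encard ≤
      sepOrder G A B := by
  have h : Disjoint (link G A B D C) (centre G A B C D) :=
    centre_swap_right G A B C D ▸ disjoint_link_centre G A B D C
  rw [← encard_union_eq (disjoint_link_link G A B C D),
    ← encard_union_eq (disjoint_union_left.2 ⟨disjoint_link_centre G A B C D, h⟩),
    ← encard_sepElems]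
  exact encard_le_encard (union_subset (union_subset (link_subset_sepElems _ _ _ _ _)
    (link_subset_sepElems _ _ _ _ _)) (centre_subset_sepElems _ _ _ _ _))

/-- In a `k`-connected graph, if the separations cross and the vertex-centre has fewer than `k`
elements, then the `A`-link, the `D`-link and the set of diagonal edges at the corner for `AD`
are not all empty. -/
lemma Crosses.not_links_empty {G : SimpleGraph V} {k : ℕ} {A B C D : Set V}
    (hG : KConnected G k) (hAB : IsMixedSep A B) (hCD : IsMixedSep C D)
    (hcross : Crosses A B C D) (hv : (vertexCentre A B C D).encard < k)
    (hA : link G C D A B = ∅) (hD : link G A B D C = ∅)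
    (hdiag : diagonalEdges G A B D C = ∅) : False := by
  have hABu : ∀ x, x ∈ A ∨ x ∈ B := fun x => by
    have := mem_univ x; rwa [← hAB.1] at this
  have hCDu : ∀ x, x ∈ C ∨ x ∈ D := fun x => by
    have := mem_univ x; rwa [← hCD.1] at this
  have hAv : ∀ x, ¬(x ∈ A ∧ x ∉ B ∧ x ∈ C ∧ x ∈ D) := fun x hx => by
    have : (Sum.inl x : V ⊕ Sym2 V) ∈ link G C D A B :=
      Or.inl ⟨x, ⟨⟨hx.1, hx.2.1⟩, hx.2.2⟩, rfl⟩
    simp [hA] at this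
  have hDv : ∀ x, ¬(x ∈ D ∧ x ∉ C ∧ x ∈ A ∧ x ∈ B) := fun x hx => by
    have : (Sum.inl x : V ⊕ Sym2 V) ∈ link G A B D C :=
      Or.inl ⟨x, ⟨⟨hx.1, hx.2.1⟩, hx.2.2⟩, rfl⟩
    simp [hD] at this
  obtain ⟨p, hp⟩ : (corner A B D C).Nonempty := by
    by_contra hne
    have hc : ∀ x, ¬((x ∈ A ∧ x ∉ B) ∧ x ∈ D ∧ x ∉ C) := fun x hx => hne ⟨x, hx⟩
    refine hcross (Or.inl ⟨fun x hx => ?_, fun x hx => ?_⟩) <;>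
      grind
  obtain ⟨q, hq⟩ := hAB.2.2
  have hpX : p ∈ (vertexCentre A B C D)ᶜ := fun h => hp.1.2 h.1.1.2
  have hqX : q ∈ (vertexCentre A B C D)ᶜ := fun h => hq.2 h.1.1.1
  obtain ⟨w⟩ := (hG.2 _ hv).preconnected ⟨p, hpX⟩ ⟨q, hqX⟩
  obtain ⟨d, -, hd1, hd2⟩ := w.exists_boundary_dart (Subtype.val ⁻¹' corner A B D C) hp
    (fun h => hq.2 h.1.1)
  obtain ⟨x, hx, y, hy, hxc, hyc, hadj⟩ : ∃ x, ∃ _ : x ∈ (vertexCentre A B C D)ᶜ,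
      ∃ y, ∃ _ : y ∈ (vertexCentre A B C D)ᶜ,
      x ∈ corner A B D C ∧ y ∉ corner A B D C ∧ G.Adj x y :=
    ⟨d.fst.1, d.fst.2, d.snd.1, d.snd.2, hd1, hd2, d.adj⟩
  have hxA := hxc.1
  have hxD := hxc.2
  by_cases hyA : y ∈ B \ A
  · by_cases hyC : y ∈ C \ D
    · have : s(x, y) ∈ diagonalEdges G A B D C := ⟨hadj, x, y, rfl, hxc, hyA, hyC⟩
      simp [hdiag] at this
    · have : (Sum.inr s(x, y) : V ⊕ Sym2 V) ∈ link G A B D C := by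
        refine Or.inr ⟨_, ⟨⟨hadj, x, y, rfl, hxA, hyA⟩, ?_, x, by simp, Or.inl hxc⟩, rfl⟩
        rintro ⟨-, a, b, h, h'⟩
        simp only [corner, mem_inter_iff, mem_sdiff] at *
        rcases Sym2.eq_iff.1 h with ⟨rfl, rfl⟩ | ⟨rfl, rfl⟩ <;> tauto
      simp [hD] at this
  · have hyC : y ∈ C \ D := by
      simp only [corner, vertexCentre, mem_inter_iff, mem_sdiff, mem_compl_iff] at *
      grind
    have : (Sum.inr s(x, y) : V ⊕ Sym2 V) ∈ link G C D A B := by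
      refine Or.inr ⟨_, ⟨⟨hadj, y, x, Sym2.eq_swap, hyC, hxD⟩, ?_, x, by simp,
        Or.inr ⟨hxD, hxA⟩⟩, rfl⟩
      rintro ⟨-, a, b, h, h'⟩
      simp only [corner, mem_inter_iff, mem_sdiff] at *
      rcases Sym2.eq_iff.1 h with ⟨rfl, rfl⟩ | ⟨rfl, rfl⟩ <;> tauto
    simp [hA] at this

lemma Crosses.exists_link_sizes {G : SimpleGraph V} {k : ℕ} {A B C D : Set V}
    (hG : KConnected G k) (hAB : IsMixedSep A B) (hABord : sepOrder G A B = (k : ℕ∞))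
    (hCD : IsMixedSep C D) (hCDord : sepOrder G C D = (k : ℕ∞)) (hcross : Crosses A B C D)
    (hAC : (k : ℕ∞) ≤ (cornerSep G A B C D).encard)
    (hBD : (k : ℕ∞) ≤ (cornerSep G B A D C).encard) :
    ∃ x y z : ℕ, x + y + z = k ∧ (x = y ∨ 1 ≤ x ∧ 1 ≤ y) ∧
      (link G C D A B).encard = x ∧ (link G A B D C).encard = x ∧
      (link G C D B A).encard = y ∧ (link G A B C D).encard = y ∧
      (centre G A B C D).encard = z := by
  have h1 := link_add_link_add_centre_le G A B C D
  have h2 := link_add_link_add_centre_le G C D A B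
  have h3 := hAC.trans (encard_cornerSep_le G A B C D)
  have h4 := hBD.trans (encard_cornerSep_le G B A D C)
  have e2 : vertexCentre B A D C = vertexCentre A B C D := by
    simp only [vertexCentre, inter_comm, inter_left_comm]
  rw [link_swap_left G C D B A, link_swap_left G A B D C, diagonalEdges_flip, e2] at h4
  rw [centre_swap] at h2
  rw [hABord, encard_centre] at h1
  rw [hCDord, encard_centre] at h2
  have key := fun hv => Crosses.not_links_empty hG hAB hCD hcross hv
  have key' := fun hv => Crosses.not_links_empty hG hCD hAB hcross.symm hv
  rw [vertexCentre_swap, diagonalEdges_swap] at key'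
  rw [encard_centre]
  simp only [← encard_eq_zero] at key key'
  generalize (link G C D A B).encard = a at *
  generalize (link G C D B A).encard = b at *
  generalize (link G A B C D).encard = c at *
  generalize (link G A B D C).encard = d at *
  generalize (vertexCentre A B C D).encard = v at *
  generalize (diagonalEdges G A B C D).encard = m at *
  generalize (diagonalEdges G A B D C).encard = n at *
  lift a to ℕ using by rintro rfl; simp at h2
  lift b to ℕ using by rintro rfl; simp at h2
  lift c to ℕ using by rintro rfl; simp at h1
  lift d to ℕ using by rintro rfl; simp at h1
  lift v to ℕ using by rintro rfl; simp at h1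
  lift m to ℕ using by rintro rfl; simp at h1
  lift n to ℕ using by rintro rfl; simp at h1
  norm_cast at *
  refine ⟨a, b, v + (m + n), by omega, ?_, rfl, by omega, rfl, by omega, rfl⟩
  by_contra hne
  by_cases ha : a = 0
  · exact key (by omega) ha (by omega) (by omega)
  · exact key' (by omega) (by omega) (by omega) (by omega)

/-- how mixed-k-separations cross. -/
theorem crossing_mixed_separations (G : SimpleGraph V) (k : ℕ) (A B C D : Set V)
    (hG : KConnected G k)
    (hAB : IsMixedSep A B) (hABord : sepOrder G A B = (k : ℕ∞))
    (hCD : IsMixedSep C D) (hCDord : sepOrder G C D = (k : ℕ∞))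
    (hcross : Crosses A B C D)
    (hopp : ((k : ℕ∞) ≤ (cornerSep G A B C D).encard ∧
              (k : ℕ∞) ≤ (cornerSep G B A D C).encard) ∨
            ((k : ℕ∞) ≤ (cornerSep G A B D C).encard ∧
              (k : ℕ∞) ≤ (cornerSep G B A C D).encard)) :
    (∃ l : ℕ, l ≤ k / 2 ∧
      (link G C D A B).encard = (l : ℕ∞) ∧ (link G C D B A).encard = (l : ℕ∞) ∧
      (link G A B C D).encard = (l : ℕ∞) ∧ (link G A B D C).encard = (l : ℕ∞) ∧
      (centre G A B C D).encard = ((k - 2 * l : ℕ) : ℕ∞)) ∨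
    (∃ i j : ℕ, 1 ≤ i ∧ i ≤ (k - 1) / 2 ∧ i < j ∧ j ≤ k - i ∧
      (centre G A B C D).encard = ((k - i - j : ℕ) : ℕ∞) ∧
      (((link G C D A B).encard = (i : ℕ∞) ∧ (link G A B C D).encard = (i : ℕ∞) ∧
          (link G C D B A).encard = (j : ℕ∞) ∧ (link G A B D C).encard = (j : ℕ∞)) ∨
       ((link G C D A B).encard = (i : ℕ∞) ∧ (link G A B D C).encard = (i : ℕ∞) ∧
          (link G C D B A).encard = (j : ℕ∞) ∧ (link G A B C D).encard = (j : ℕ∞)) ∨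
       ((link G C D B A).encard = (i : ℕ∞) ∧ (link G A B C D).encard = (i : ℕ∞) ∧
          (link G C D A B).encard = (j : ℕ∞) ∧ (link G A B D C).encard = (j : ℕ∞)) ∨
       ((link G C D B A).encard = (i : ℕ∞) ∧ (link G A B D C).encard = (i : ℕ∞) ∧
          (link G C D A B).encard = (j : ℕ∞) ∧ (link G A B C D).encard = (j : ℕ∞)))) := by
  rcases hopp with ⟨h₁, h₂⟩ | ⟨h₁, h₂⟩
  · obtain ⟨x, y, z, hk, hxy, hA, hD, hB, hC, hz⟩ :=
      hcross.exists_link_sizes hG hAB hABord hCD hCDord h₁ h₂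
    rw [hA, hB, hC, hD, hz]
    norm_cast
    rcases lt_trichotomy x y with h | h | h
    · exact Or.inr ⟨x, y, by omega⟩
    · exact Or.inl ⟨x, by omega⟩
    · exact Or.inr ⟨y, x, by omega⟩
  · obtain ⟨x, y, z, hk, hxy, hA, hC, hB, hD, hz⟩ :=
      hcross.swap_right.exists_link_sizes hG hAB hABord hCD.symm
        ((sepOrder_comm G C D).trans hCDord) h₁ h₂
    rw [link_swap_left] at hA hB
    rw [centre_swap_right] at hz
    rw [hA, hB, hC, hD, hz]
    norm_cast
    rcases lt_trichotomy x y with h | h | h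
    · exact Or.inr ⟨x, y, by omega⟩
    · exact Or.inl ⟨x, by omega⟩
    · exact Or.inr ⟨y, x, by omega⟩

end Paper
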